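/- Let s ∈ ℂ and for each integer N ≥ 0 define I_N(s) = −e^{iπ/4} ∫_{-∞}^{∞} e^{iπ z(t)²} z(t)^{-s} / (e^{iπ z(t)} − e^{-iπ z(t)}) dt, where z(t) = N + 1/2 + e^{iπ/4} t and the power is principal. Then for every integer N ≥ 1, I_0(s) = Σ_{n=1}^{N} n^{-s} + I_N(s); equivalently, I_N(s) = I_{N-1}(s) − N^{-s} for all N ≥ 1. -/

import Mathlib

open Real Set
open Complex (I)

/-- The Riemann–Siegel contour integral
`I_N(s) = -e^{iπ/4} ∫_ℝ e^{iπz(t)²} z(t)^{-s}/(e^{iπz(t)} - e^{-iπz(t)}) dt`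
along the line `z(t) = N + 1/2 + e^{iπ/4} t`, traversed downward from the first
quadrant to the third quadrant. -/
noncomputable def rsIntegral (s : ℂ) (N : ℕ) : ℂ :=
  -(Complex.exp (I * (π : ℂ) / 4) *
    ∫ t : ℝ,
      Complex.exp (I * (π : ℂ)
            * (((N : ℂ) + 1/2) + Complex.exp (I * (π : ℂ) / 4) * (t : ℂ)) ^ 2) *
          (((N : ℂ) + 1/2) + Complex.exp (I * (π : ℂ) / 4) * (t : ℂ)) ^ (-s) /
        (Complex.exp (I * (π : ℂ)
              * (((N : ℂ) + 1/2) + Complex.exp (I * (π : ℂ) / 4) * (t : ℂ)))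
          - Complex.exp (-(I * (π : ℂ)
              * (((N : ℂ) + 1/2) + Complex.exp (I * (π : ℂ) / 4) * (t : ℂ))))))


open MeasureTheory Filter Topology

theorem integral_horizontal_shift {g : ℂ → ℂ} {y₁ y₂ C R : ℝ}
    (hd : ∀ x y : ℝ, y ∈ Set.uIcc y₁ y₂ → DifferentiableAt ℂ g (x + y * I))
    (hb : ∀ x y : ℝ, y ∈ Set.uIcc y₁ y₂ → R ≤ |x| →
      ‖g (x + y * I)‖ ≤ C * Real.exp (-x ^ 2))
    (h₁ : Integrable fun x : ℝ => g (x + y₁ * I))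
    (h₂ : Integrable fun x : ℝ => g (x + y₂ * I)) :
    ∫ x : ℝ, g (x + y₁ * I) = ∫ x : ℝ, g (x + y₂ * I) := by
  have hexp : Tendsto (fun T : ℝ => C * Real.exp (-T ^ 2) * |y₂ - y₁|) atTop (𝓝 0) := by
    have : Tendsto (fun T : ℝ => Real.exp (-T ^ 2)) atTop (𝓝 0) :=
      Real.tendsto_exp_atBot.comp
        (tendsto_neg_atTop_atBot.comp (tendsto_pow_atTop two_ne_zero))
    simpa using (this.const_mul C).mul_const |y₂ - y₁|
  have hside : ∀ ε : ℝ, |ε| = 1 → Tendsto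
      (fun T : ℝ => ∫ y in y₁..y₂, g ((ε * T : ℝ) + y * I)) atTop (𝓝 0) := by
    intro ε hε
    refine squeeze_zero_norm' ?_ hexp
    filter_upwards [eventually_ge_atTop (max R 0)] with T hT
    refine intervalIntegral.norm_integral_le_of_norm_le_const fun y hy => ?_
    have hT' : |ε * T| = T := by
      rw [abs_mul, hε, one_mul, abs_of_nonneg ((le_max_right _ _).trans hT)]
    have := hb (ε * T) y (Set.uIoc_subset_uIcc hy) (by rw [hT']; exact (le_max_left _ _).trans hT)
    rwa [← sq_abs, hT'] at this
  have hrect : ∀ T : ℝ, (∫ x in -T..T, g (x + y₁ * I)) - (∫ x in -T..T, g (x + y₂ * I)) +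
      I • (∫ y in y₁..y₂, g ((1 * T : ℝ) + y * I)) -
      I • (∫ y in y₁..y₂, g ((-1 * T : ℝ) + y * I)) = 0 := by
    intro T
    have := Complex.integral_boundary_rect_eq_zero_of_differentiableOn g ⟨-T, y₁⟩ ⟨T, y₂⟩
      (fun w hw => by
        have := hd w.re w.im hw.2
        rw [Complex.re_add_im] at this
        exact this.differentiableWithinAt)
    simpa using this
  have hlim := (((intervalIntegral_tendsto_integral h₁ tendsto_neg_atTop_atBot tendsto_id).sub
    (intervalIntegral_tendsto_integral h₂ tendsto_neg_atTop_atBot tendsto_id)).add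
    ((hside 1 (by simp)).const_smul I)).sub ((hside (-1) (by simp)).const_smul I)
  simp only [id] at hlim
  rw [funext hrect] at hlim
  have := tendsto_nhds_unique hlim tendsto_const_nhds
  simpa [sub_eq_zero] using this

/-- The integrand of the Riemann–Siegel integral. -/
noncomputable def rsKernel (s z : ℂ) : ℂ :=
  Complex.exp (I * (π : ℂ) * z ^ 2) * z ^ (-s) /
    (Complex.exp (I * (π : ℂ) * z) - Complex.exp (-(I * (π : ℂ) * z)))

theorem exp_I_pi_div_four : Complex.exp (I * (π : ℂ) / 4) = (√2 / 2 : ℝ) * (1 + I) := by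
  rw [show I * (π : ℂ) / 4 = (π / 4 : ℝ) * I by push_cast; ring, Complex.exp_mul_I,
    ← Complex.ofReal_cos, ← Complex.ofReal_sin, Real.cos_pi_div_four, Real.sin_pi_div_four]
  ring

theorem exp_I_pi_div_four_sq : Complex.exp (I * (π : ℂ) / 4) ^ 2 = I := by
  rw [← Complex.exp_nat_mul, show ((2 : ℕ) : ℂ) * (I * (π : ℂ) / 4) = π / 2 * I by push_cast; ring,
    Complex.exp_pi_div_two_mul_I]

theorem rotated_re (x y : ℝ) :
    (Complex.exp (I * (π : ℂ) / 4) * (x + y * I)).re = √2 / 2 * (x - y) := by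
  rw [exp_I_pi_div_four, mul_assoc, Complex.re_ofReal_mul]; simp

theorem rotated_im (x y : ℝ) :
    (Complex.exp (I * (π : ℂ) / 4) * (x + y * I)).im = √2 / 2 * (x + y) := by
  rw [exp_I_pi_div_four, mul_assoc, Complex.im_ofReal_mul]; simp; ring

theorem rotated_norm_le (x y : ℝ) :
    ‖Complex.exp (I * (π : ℂ) / 4) * (x + y * I)‖ ≤ |x| + |y| := by
  rw [norm_mul, show I * (π : ℂ) / 4 = (π / 4 : ℝ) * I by push_cast; ring,
    Complex.norm_exp_ofReal_mul_I, one_mul]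
  simpa using Complex.norm_le_abs_re_add_abs_im (x + y * I)

theorem norm_gaussian_rotated (x y : ℝ) :
    ‖Complex.exp (I * (π : ℂ) * (Complex.exp (I * (π : ℂ) / 4) * (x + y * I)) ^ 2)‖ =
      Real.exp (-π * (x ^ 2 - y ^ 2)) := by
  rw [mul_pow, exp_I_pi_div_four_sq, Complex.norm_exp]
  congr 1
  have : I * (π : ℂ) * (I * (x + y * I) ^ 2) =
      (-π * (x ^ 2 - y ^ 2) : ℝ) + (-2 * π * x * y : ℝ) * I := by
    push_cast
    linear_combination (2 * π * x * y * I + π * (x ^ 2 - y ^ 2) + π * y ^ 2 * I ^ 2) *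
      Complex.I_sq
  rw [this, Complex.add_re, Complex.ofReal_re, Complex.re_ofReal_mul]; simp

theorem one_le_norm_rs_denom {z : ℂ} (hz : 1 ≤ |z.im|) :
    1 ≤ ‖Complex.exp (I * (π : ℂ) * z) - Complex.exp (-(I * (π : ℂ) * z))‖ := by
  have h₁ : ‖Complex.exp (I * (π : ℂ) * z)‖ = Real.exp (-(π * z.im)) := by
    rw [Complex.norm_exp]; simp
  have h₂ : ‖Complex.exp (-(I * (π : ℂ) * z))‖ = Real.exp (π * z.im) := by
    rw [Complex.norm_exp]; simp
  have key : ∀ v : ℝ, 1 ≤ v → 1 ≤ Real.exp (π * v) - Real.exp (-(π * v)) := by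
    intro v hv
    have hp : 3 ≤ π * v := by nlinarith [Real.pi_gt_three]
    have := Real.add_one_le_exp (π * v)
    have : Real.exp (-(π * v)) ≤ 1 := Real.exp_le_one_iff.2 (by linarith)
    linarith
  rcases le_abs.1 hz with h | h
  · have := norm_sub_norm_le (Complex.exp (-(I * (π : ℂ) * z))) (Complex.exp (I * (π : ℂ) * z))
    rw [h₁, h₂, norm_sub_rev] at this
    exact (key _ h).trans this
  · have := norm_sub_norm_le (Complex.exp (I * (π : ℂ) * z)) (Complex.exp (-(I * (π : ℂ) * z)))
    rw [h₁, h₂] at this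
    refine (key _ h).trans ?_
    simpa using this

theorem norm_cpow_le_exp {z : ℂ} (hz : 1 ≤ ‖z‖) (s : ℂ) :
    ‖z ^ s‖ ≤ Real.exp (‖s‖ * (‖z‖ + π)) := by
  have hz0 : z ≠ 0 := by rintro rfl; norm_num at hz
  rw [Complex.cpow_def_of_ne_zero hz0]
  refine (Complex.norm_exp_le_exp_norm _).trans (Real.exp_le_exp.2 ?_)
  rw [norm_mul, mul_comm]
  refine mul_le_mul_of_nonneg_left ?_ (norm_nonneg s)
  have h := Complex.norm_le_abs_re_add_abs_im (Complex.log z)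
  rw [Complex.log_re, Complex.log_im, abs_of_nonneg (Real.log_nonneg hz)] at h
  linarith [Real.log_le_self (norm_nonneg z), Complex.abs_arg_le_pi z]

theorem exists_norm_rsKernel_rotated_le (s : ℂ) (c : ℝ) :
    ∃ C : ℝ, ∀ x y : ℝ, |y| ≤ c → c + 2 ≤ |x| →
      ‖rsKernel s (Complex.exp (I * (π : ℂ) / 4) * (x + y * I))‖ ≤ C * Real.exp (-x ^ 2) := by
  refine ⟨Real.exp (π * c ^ 2 + ‖s‖ * (c + π) + ‖s‖ ^ 2), fun x y hy hx => ?_⟩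
  set z := Complex.exp (I * (π : ℂ) / 4) * (x + y * I) with hz
  have him : 1 ≤ |z.im| := by
    rw [hz, rotated_im, abs_mul, abs_of_pos (by positivity)]
    have h1 : 2 ≤ |x + y| := by
      have := abs_sub_abs_le_abs_sub x (-y)
      rw [abs_neg, sub_neg_eq_add] at this
      linarith
    have h2 : 1 ≤ √2 := Real.one_le_sqrt.2 (by norm_num)
    nlinarith
  have hnorm : 1 ≤ ‖z‖ := him.trans (Complex.abs_im_le_norm z)
  have hpow : ‖z ^ (-s)‖ ≤ Real.exp (‖s‖ * (|x| + c + π)) := by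
    refine (norm_cpow_le_exp hnorm _).trans (Real.exp_le_exp.2 ?_)
    rw [norm_neg]
    refine mul_le_mul_of_nonneg_left ?_ (norm_nonneg s)
    linarith [rotated_norm_le x y]
  rw [rsKernel, norm_div, norm_mul, norm_gaussian_rotated]
  refine (div_le_self (by positivity) (one_le_norm_rs_denom him)).trans ?_
  refine (mul_le_mul_of_nonneg_left hpow (Real.exp_nonneg _)).trans ?_
  rw [← Real.exp_add, ← Real.exp_add, Real.exp_le_exp]
  have hy2 : y ^ 2 ≤ c ^ 2 := sq_le_sq' (by linarith [abs_le.1 hy]) (by linarith [abs_le.1 hy])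
  have hpi := Real.pi_gt_three
  have hxx : |x| ^ 2 = x ^ 2 := sq_abs x
  nlinarith [sq_nonneg (|x| - ‖s‖), mul_le_mul_of_nonneg_left hy2 (by linarith : 0 ≤ π),
    mul_nonneg (by linarith : 0 ≤ π - 3) (sq_nonneg x), sq_nonneg x, sq_nonneg ‖s‖]

theorem rs_denom_eq_zero_iff {z : ℂ} :
    Complex.exp (I * (π : ℂ) * z) - Complex.exp (-(I * (π : ℂ) * z)) = 0 ↔ ∃ k : ℤ, z = k := by
  have hpi : (π : ℂ) ≠ 0 := Complex.ofReal_ne_zero.2 Real.pi_ne_zero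
  rw [sub_eq_zero, Complex.exp_eq_exp_iff_exists_int]
  refine exists_congr fun k => ⟨fun h => ?_, fun h => ?_⟩
  · have : (2 * I * π) * z = (2 * I * π) * k := by linear_combination h
    exact mul_left_cancel₀ (by simp [hpi]) this
  · rw [h]; ring

theorem rotated_mem_slitPlane (x : ℝ) {y : ℝ} (hy : y < 0) :
    Complex.exp (I * (π : ℂ) / 4) * (x + y * I) ∈ Complex.slitPlane := by
  rw [Complex.mem_slitPlane_iff, rotated_re, rotated_im]
  by_cases h : x + y = 0
  · left
    have : 0 < x - y := by linarith
    positivity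
  · right
    have : √2 / 2 ≠ 0 := by positivity
    exact mul_ne_zero this h

theorem rotated_eq_int {x y : ℝ} {k : ℤ}
    (h : Complex.exp (I * (π : ℂ) / 4) * (x + y * I) = k) : -(√2 * y) = k := by
  have hre := congrArg Complex.re h
  have him := congrArg Complex.im h
  rw [rotated_re] at hre
  rw [rotated_im] at him
  simp only [Complex.intCast_re, Complex.intCast_im] at hre him
  linarith

theorem differentiableAt_rsKernel (s : ℂ) {z : ℂ} (hz : z ∈ Complex.slitPlane)
    (hz' : ∀ k : ℤ, z ≠ k) : DifferentiableAt ℂ (rsKernel s) z := by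
  have hD : Complex.exp (I * (π : ℂ) * z) - Complex.exp (-(I * (π : ℂ) * z)) ≠ 0 := fun h =>
    (rs_denom_eq_zero_iff.1 h).elim hz'
  refine DifferentiableAt.div (DifferentiableAt.mul (by fun_prop) ?_) (by fun_prop) hD
  exact differentiableAt_id.cpow_const hz

theorem integrable_rsKernel_rotated (s : ℂ) {y : ℝ} (hy : y < 0)
    (hy' : ∀ k : ℤ, -(√2 * y) ≠ k) :
    Integrable fun x : ℝ => rsKernel s (Complex.exp (I * (π : ℂ) / 4) * (x + y * I)) := by
  have hcont : Continuous fun x : ℝ =>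
      rsKernel s (Complex.exp (I * (π : ℂ) / 4) * (x + y * I)) := by
    refine continuous_iff_continuousAt.2 fun x => ?_
    have h := (differentiableAt_rsKernel s (rotated_mem_slitPlane x hy)
      (fun k hk => hy' k (rotated_eq_int hk))).continuousAt
    exact ContinuousAt.comp
      (f := fun x : ℝ => Complex.exp (I * (π : ℂ) / 4) * (x + y * I)) h (by fun_prop)
  obtain ⟨C, hC⟩ := exists_norm_rsKernel_rotated_le s |y|
  have hO : (fun x : ℝ => rsKernel s (Complex.exp (I * (π : ℂ) / 4) * (x + y * I)))
      =O[cocompact ℝ] fun x : ℝ => Real.exp (-1 * x ^ 2) := by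
    refine Asymptotics.IsBigO.of_bound C ?_
    filter_upwards [tendsto_norm_cocompact_atTop.eventually_ge_atTop (|y| + 2)] with x hx
    simpa using hC x y le_rfl hx
  exact hcont.locallyIntegrable.integrable_of_isBigO_cocompact hO
    ((integrable_exp_neg_mul_sq one_pos).integrableAtFilter _)

theorem rotated_line (N : ℕ) (t : ℝ) :
    (((N : ℂ) + 1 / 2) + Complex.exp (I * (π : ℂ) / 4) * (t : ℂ)) =
      Complex.exp (I * (π : ℂ) / 4) *
        ((t + (N + 1 / 2) * (√2 / 2) : ℝ) + (-((N + 1 / 2) * (√2 / 2)) : ℝ) * I) := by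
  have h2 : ((√2 : ℝ) : ℂ) ^ 2 = 2 := by rw [← Complex.ofReal_pow]; norm_num
  rw [exp_I_pi_div_four]
  push_cast
  linear_combination (N + 1 / 2 : ℂ) * (-(1 - I ^ 2) / 4) * h2 + (N + 1 / 2 : ℂ) / 2 * Complex.I_sq

theorem height_ne_int (N : ℕ) (k : ℤ) : -(√2 * -(((N : ℝ) + 1 / 2) * (√2 / 2))) ≠ k := by
  have h2 : √2 * √2 = 2 := Real.mul_self_sqrt (by norm_num)
  intro h
  have h' : 2 * (N : ℝ) + 1 = 2 * k := by linear_combination 2 * h - ((N : ℝ) + 1 / 2) * h2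
  have : 2 * (N : ℤ) + 1 = 2 * k := by exact_mod_cast h'
  omega

theorem integrable_rsKernel_line (s : ℂ) (N : ℕ) :
    Integrable fun t : ℝ =>
      rsKernel s (((N : ℂ) + 1 / 2) + Complex.exp (I * (π : ℂ) / 4) * (t : ℂ)) := by
  simp_rw [rotated_line]
  have hy : -(((N : ℝ) + 1 / 2) * (√2 / 2)) < 0 := neg_neg_of_pos (by positivity)
  exact (integrable_rsKernel_rotated s hy (height_ne_int N)).comp_add_right
    (((N : ℝ) + 1 / 2) * (√2 / 2))

theorem integral_line_eq (f : ℂ → ℂ) (N : ℕ) :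
    ∫ t : ℝ, f (((N : ℂ) + 1 / 2) + Complex.exp (I * (π : ℂ) / 4) * (t : ℂ)) =
      ∫ x : ℝ, f (Complex.exp (I * (π : ℂ) / 4) *
        (x + (-((N + 1 / 2) * (√2 / 2)) : ℝ) * I)) := by
  simp_rw [rotated_line]
  exact integral_add_right_eq_self (fun x : ℝ => f (Complex.exp (I * (π : ℂ) / 4) *
        (x + (-((N + 1 / 2) * (√2 / 2)) : ℝ) * I))) (((N : ℝ) + 1 / 2) * (√2 / 2))

theorem rsIntegral_eq (s : ℂ) (N : ℕ) :
    rsIntegral s N = -(Complex.exp (I * (π : ℂ) / 4) * ∫ t : ℝ,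
      rsKernel s (((N : ℂ) + 1 / 2) + Complex.exp (I * (π : ℂ) / 4) * (t : ℂ))) := rfl

theorem rsKernel_zero_add_one_sub {z : ℂ} (hz : ∀ k : ℤ, z ≠ k) :
    rsKernel 0 (z + 1) - rsKernel 0 z = Complex.exp (I * (π : ℂ) * (z ^ 2 + z)) := by
  have hD : Complex.exp (I * (π : ℂ) * z) - Complex.exp (-(I * (π : ℂ) * z)) ≠ 0 := fun h =>
    (rs_denom_eq_zero_iff.1 h).elim hz
  have h1 : Complex.exp (I * (π : ℂ) * (z + 1)) = -Complex.exp (I * (π : ℂ) * z) := by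
    rw [mul_add, mul_one, Complex.exp_add, mul_comm I (π : ℂ), Complex.exp_pi_mul_I]; ring
  have h2 : Complex.exp (-(I * (π : ℂ) * (z + 1))) = -Complex.exp (-(I * (π : ℂ) * z)) := by
    rw [Complex.exp_neg, h1, inv_neg, ← Complex.exp_neg]
  have h3 : Complex.exp (I * (π : ℂ) * (z + 1) ^ 2) =
      -(Complex.exp (I * (π : ℂ) * z ^ 2) * Complex.exp (I * (π : ℂ) * z) ^ 2) := by
    rw [← Complex.exp_nat_mul, ← Complex.exp_add, ← neg_one_mul, ← Complex.exp_pi_mul_I,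
      ← Complex.exp_add]
    congr 1; push_cast; ring
  have h4 : Complex.exp (I * (π : ℂ) * z) * Complex.exp (-(I * (π : ℂ) * z)) = 1 := by
    rw [← Complex.exp_add, add_neg_cancel, Complex.exp_zero]
  have h5 : Complex.exp (I * (π : ℂ) * (z ^ 2 + z)) =
      Complex.exp (I * (π : ℂ) * z ^ 2) * Complex.exp (I * (π : ℂ) * z) := by
    rw [← Complex.exp_add, mul_add]
  simp only [rsKernel, neg_zero, Complex.cpow_zero, mul_one]
  rw [h1, h2, h3, h5, neg_sub_neg, ← neg_sub (Complex.exp (I * (π : ℂ) * z)), neg_div_neg_eq,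
    ← sub_div, div_eq_iff hD]
  linear_combination Complex.exp (I * (π : ℂ) * z ^ 2) * h4

theorem integral_exp_line (N : ℕ) :
    Complex.exp (I * (π : ℂ) / 4) * ∫ t : ℝ, Complex.exp (I * (π : ℂ) *
      ((((N : ℂ) + 1 / 2) + Complex.exp (I * (π : ℂ) / 4) * (t : ℂ)) ^ 2 +
        (((N : ℂ) + 1 / 2) + Complex.exp (I * (π : ℂ) / 4) * (t : ℂ)))) = 1 := by
  have hpi : (π : ℂ) ≠ 0 := Complex.ofReal_ne_zero.2 Real.pi_ne_zero
  have hω := exp_I_pi_div_four_sq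
  set ω := Complex.exp (I * (π : ℂ) / 4) with hω'
  have hrw : ∀ t : ℝ, I * (π : ℂ) * ((((N : ℂ) + 1 / 2) + ω * (t : ℂ)) ^ 2 +
      (((N : ℂ) + 1 / 2) + ω * (t : ℂ))) =
      -(π : ℂ) * (t : ℂ) ^ 2 + (2 * I * π * (N + 1) * ω) * t +
        I * π * ((N + 1) ^ 2 - 1 / 4) := by
    intro t
    linear_combination I * (π : ℂ) * t ^ 2 * hω + (π : ℂ) * t ^ 2 * Complex.I_sq
  simp_rw [hrw]
  rw [integral_cexp_quadratic (by simpa using Real.pi_pos), neg_neg, div_self hpi,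
    Complex.one_cpow, one_mul, hω', ← Complex.exp_add, ← hω']
  have : (2 * I * π * (N + 1) * ω) ^ 2 / (4 * -(π : ℂ)) = I * π * (N + 1) ^ 2 := by
    rw [div_eq_iff (by simp [hpi])]
    linear_combination (4 * I ^ 2 * (π : ℂ) ^ 2 * (N + 1) ^ 2) * hω +
      (4 * I * (π : ℂ) ^ 2 * (N + 1) ^ 2) * Complex.I_sq
  rw [this, show I * (π : ℂ) / 4 + (I * π * ((N + 1) ^ 2 - 1 / 4) - I * π * (N + 1) ^ 2) = 0 by ring,
    Complex.exp_zero]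

theorem line_ne_int (N : ℕ) (t : ℝ) (k : ℤ) :
    ((N : ℂ) + 1 / 2) + Complex.exp (I * (π : ℂ) / 4) * (t : ℂ) ≠ k := by
  rw [rotated_line]
  exact fun h => height_ne_int N k (rotated_eq_int h)

theorem integral_rsKernel_zero_succ_sub (N : ℕ) :
    Complex.exp (I * (π : ℂ) / 4) * ((∫ t : ℝ, rsKernel 0
      (((N + 1 : ℕ) : ℂ) + 1 / 2 + Complex.exp (I * (π : ℂ) / 4) * (t : ℂ))) -
      ∫ t : ℝ, rsKernel 0 (((N : ℂ) + 1 / 2) + Complex.exp (I * (π : ℂ) / 4) * (t : ℂ))) = 1 := by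
  rw [← integral_sub (integrable_rsKernel_line 0 _) (integrable_rsKernel_line 0 _)]
  refine Eq.trans ?_ (integral_exp_line N)
  congr 2 with t
  rw [← rsKernel_zero_add_one_sub (line_ne_int N t)]
  congr 2
  push_cast; ring

/-- The holomorphic extension across `n` of `rsKernel s z - n ^ (-s) * rsKernel 0 z`. -/
noncomputable def rsRegular (s : ℂ) (n : ℕ) (z : ℂ) : ℂ :=
  Complex.exp (I * (π : ℂ) * z ^ 2) * dslope (fun z => z ^ (-s)) (n : ℂ) z /
    dslope (fun z => Complex.exp (I * (π : ℂ) * z) - Complex.exp (-(I * (π : ℂ) * z))) (n : ℂ) z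

theorem rsRegular_of_ne (s : ℂ) {n : ℕ} {z : ℂ} (hz : z ≠ n) :
    rsRegular s n z = rsKernel s z - (n : ℂ) ^ (-s) * rsKernel 0 z := by
  have hn := (rs_denom_eq_zero_iff (z := (n : ℂ))).2 ⟨n, by simp⟩
  have hz' : z - n ≠ 0 := sub_ne_zero.2 hz
  rw [rsRegular, dslope_of_ne _ hz, dslope_of_ne _ hz, slope_def_field, slope_def_field, hn,
    sub_zero, ← mul_div_assoc, div_div_div_cancel_right₀ hz']
  simp only [rsKernel, neg_zero, Complex.cpow_zero, mul_one]
  ring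

theorem differentiableAt_rsRegular (s : ℂ) {n : ℕ} (hn : 0 < n) {z : ℂ}
    (hz : z ∈ Complex.slitPlane) (hz' : ∀ k : ℤ, z = k → z = n) :
    DifferentiableAt ℂ (rsRegular s n) z := by
  have hpi : (π : ℂ) ≠ 0 := Complex.ofReal_ne_zero.2 Real.pi_ne_zero
  have hopen : ∀ w ∈ Complex.slitPlane, Complex.slitPlane ∈ 𝓝 w := fun w hw =>
    Complex.isOpen_slitPlane.mem_nhds hw
  have hns : (n : ℂ) ∈ Complex.slitPlane := Complex.natCast_mem_slitPlane.2 hn.ne'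
  have hzero := (rs_denom_eq_zero_iff (z := (n : ℂ))).2 ⟨n, by simp⟩
  refine DifferentiableAt.div (DifferentiableAt.mul (by fun_prop) ?_) ?_ ?_
  · refine DifferentiableOn.differentiableAt
      ((Complex.differentiableOn_dslope (hopen _ hns)).2 fun w hw => ?_) (hopen _ hz)
    exact (differentiableAt_id.cpow_const hw).differentiableWithinAt
  · refine DifferentiableOn.differentiableAt
      ((Complex.differentiableOn_dslope (hopen _ hns)).2 ?_) (hopen _ hz)
    fun_prop
  · by_cases h : z = n
    · have hd : HasDerivAt
          (fun z => Complex.exp (I * (π : ℂ) * z) - Complex.exp (-(I * (π : ℂ) * z)))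
          (Complex.exp (I * (π : ℂ) * n) * (I * π) -
            Complex.exp (-(I * (π : ℂ) * n)) * (-(I * π))) n := by
        have h0 : HasDerivAt (fun z : ℂ => I * (π : ℂ) * z) (I * π) n := by
          simpa using (hasDerivAt_id (n : ℂ)).const_mul (I * (π : ℂ))
        exact h0.cexp.sub h0.neg.cexp
      rw [h, dslope_same, hd.deriv, ← sub_eq_zero.1 hzero]
      have : Complex.exp (I * (π : ℂ) * n) * (I * π) - Complex.exp (I * (π : ℂ) * n) * (-(I * π)) =
          2 * Complex.exp (I * (π : ℂ) * n) * (I * π) := by ring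
      rw [this]
      simp [hpi, Complex.exp_ne_zero]
    · rw [dslope_of_ne _ h, slope_def_field, hzero, sub_zero]
      exact div_ne_zero (fun h0 => h ((rs_denom_eq_zero_iff.1 h0).elim hz')) (sub_ne_zero.2 h)

theorem integral_rsRegular_line_succ (s : ℂ) (N : ℕ) :
    ∫ t : ℝ, rsRegular s (N + 1)
      (((N + 1 : ℕ) : ℂ) + 1 / 2 + Complex.exp (I * (π : ℂ) / 4) * (t : ℂ)) =
    ∫ t : ℝ, rsRegular s (N + 1)
      ((N : ℂ) + 1 / 2 + Complex.exp (I * (π : ℂ) / 4) * (t : ℂ)) := by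
  rw [integral_line_eq (rsRegular s (N + 1)), integral_line_eq (rsRegular s (N + 1))]
  have h2 : √2 * √2 = 2 := Real.mul_self_sqrt (by norm_num)
  have h2pos : 0 < √2 := by positivity
  have hneg : ∀ M : ℕ, -(((M : ℝ) + 1 / 2) * (√2 / 2)) < 0 := fun M =>
    neg_neg_of_pos (by positivity)
  have hreg : ∀ M : ℕ, Integrable fun x : ℝ => rsRegular s (N + 1) (Complex.exp (I * (π : ℂ) / 4) *
      (x + (-((M + 1 / 2) * (√2 / 2)) : ℝ) * I)) := by
    intro M
    have hne : ∀ x : ℝ, Complex.exp (I * (π : ℂ) / 4) *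
        (x + (-((M + 1 / 2) * (√2 / 2)) : ℝ) * I) ≠ (N + 1 : ℕ) := fun x h =>
      height_ne_int M (N + 1 : ℕ) (rotated_eq_int (k := (N + 1 : ℕ)) (by rw [h]; simp))
    simp_rw [fun x => rsRegular_of_ne s (hne x)]
    exact (integrable_rsKernel_rotated s (hneg M) (height_ne_int M)).sub
      ((integrable_rsKernel_rotated 0 (hneg M) (height_ne_int M)).const_mul _)
  set c : ℝ := ((N + 1 : ℕ) + 1 / 2) * (√2 / 2) with hc
  have hle : -c ≤ -(((N : ℝ) + 1 / 2) * (√2 / 2)) := by rw [hc]; push_cast; nlinarith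
  have hmem : ∀ y ∈ Set.uIcc (-c) (-(((N : ℝ) + 1 / 2) * (√2 / 2))),
      y < 0 ∧ |y| ≤ c ∧ (N : ℝ) + 1 / 2 ≤ -(√2 * y) ∧ -(√2 * y) ≤ N + 1 + 1 / 2 := by
    intro y hy
    rw [Set.uIcc_of_le hle] at hy
    have hy0 := hy.2.trans_lt (hneg N)
    refine ⟨hy0, ?_, ?_, ?_⟩
    · rw [abs_of_neg hy0]; linarith [hy.1]
    · nlinarith [mul_le_mul_of_nonneg_left hy.2 h2pos.le]
    · have := mul_le_mul_of_nonneg_left hy.1 h2pos.le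
      rw [hc] at this
      push_cast at this
      nlinarith
  obtain ⟨C₁, hC₁⟩ := exists_norm_rsKernel_rotated_le s c
  obtain ⟨C₂, hC₂⟩ := exists_norm_rsKernel_rotated_le 0 c
  refine integral_horizontal_shift
    (g := fun w => rsRegular s (N + 1) (Complex.exp (I * (π : ℂ) / 4) * w))
    (C := C₁ + ‖((N + 1 : ℕ) : ℂ) ^ (-s)‖ * C₂) (R := c + 2) ?_ ?_ (hreg (N + 1)) (hreg N)
  · intro x y hy
    obtain ⟨hy0, -, hlo, hhi⟩ := hmem y hy
    refine (differentiableAt_rsRegular s N.succ_pos (rotated_mem_slitPlane x hy0) ?_).comp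
      (x + y * I : ℂ) (by fun_prop)
    intro k hk
    rw [hk]
    rw [rotated_eq_int hk] at hlo hhi
    have h₁ : (N : ℤ) < k := by
      have : (N : ℝ) < k := by linarith
      exact_mod_cast this
    have h₂ : k < N + 2 := by
      have : (k : ℝ) < N + 2 := by linarith
      exact_mod_cast this
    have : k = (N + 1 : ℕ) := by push_cast; omega
    rw [this]; simp
  · intro x y hy hx
    obtain ⟨hy0, hyc, -, -⟩ := hmem y hy
    have hne : Complex.exp (I * (π : ℂ) / 4) * (x + y * I) ≠ (N + 1 : ℕ) := by
      intro h
      have him := congrArg Complex.im h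
      rw [rotated_im, Complex.natCast_im] at him
      have h0 : x + y = 0 := (mul_eq_zero.1 him).resolve_left (by positivity)
      rw [eq_neg_of_add_eq_zero_left h0, abs_neg] at hx
      linarith
    simp only [rsRegular_of_ne s hne]
    refine (norm_sub_le _ _).trans ?_
    rw [norm_mul, add_mul, mul_assoc]
    exact add_le_add (hC₁ x y hyc hx)
      (mul_le_mul_of_nonneg_left (hC₂ x y hyc hx) (norm_nonneg _))

theorem rsIntegral_succ (s : ℂ) (N : ℕ) :
    rsIntegral s (N + 1) = rsIntegral s N - ((N + 1 : ℕ) : ℂ) ^ (-s) := by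
  have hsplit : ∀ M : ℕ, ∫ t : ℝ, rsRegular s (N + 1)
      ((M : ℂ) + 1 / 2 + Complex.exp (I * (π : ℂ) / 4) * (t : ℂ)) =
      (∫ t : ℝ, rsKernel s ((M : ℂ) + 1 / 2 + Complex.exp (I * (π : ℂ) / 4) * (t : ℂ))) -
      ((N + 1 : ℕ) : ℂ) ^ (-s) *
        ∫ t : ℝ, rsKernel 0 ((M : ℂ) + 1 / 2 + Complex.exp (I * (π : ℂ) / 4) * (t : ℂ)) := by
    intro M
    rw [← integral_const_mul, ← integral_sub (integrable_rsKernel_line s M)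
      ((integrable_rsKernel_line 0 M).const_mul _)]
    congr 1 with t
    exact rsRegular_of_ne s (by simpa using line_ne_int M t (N + 1 : ℕ))
  have hshift := integral_rsRegular_line_succ s N
  rw [hsplit, hsplit] at hshift
  have hgauss := integral_rsKernel_zero_succ_sub N
  rw [rsIntegral_eq, rsIntegral_eq]
  linear_combination -Complex.exp (I * (π : ℂ) / 4) * hshift -
    ((N + 1 : ℕ) : ℂ) ^ (-s) * hgauss

/-- **Shifting the Riemann–Siegel contour across the poles `1, …, N`**:
`I₀(s) = Σ_{n=1}^N n^{-s} + I_N(s)`, equivalently `I_N(s) = I_{N-1}(s) - N^{-s}`,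
for every integer `N ≥ 1` and every `s ∈ ℂ`. -/
theorem rsIntegral_shift (s : ℂ) (N : ℕ) (hN : 1 ≤ N) :
    rsIntegral s 0 = (∑ n ∈ Finset.Icc 1 N, (n : ℂ) ^ (-s)) + rsIntegral s N ∧
    rsIntegral s N = rsIntegral s (N - 1) - (N : ℂ) ^ (-s) := by
  have hsum : ∀ M : ℕ,
      rsIntegral s 0 = (∑ n ∈ Finset.Icc 1 M, (n : ℂ) ^ (-s)) + rsIntegral s M := by
    intro M
    induction M with
    | zero => simp
    | succ M ih =>
      rw [Finset.sum_Icc_succ_top (by omega), rsIntegral_succ, ih]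
      ring
  obtain ⟨M, rfl⟩ := Nat.exists_eq_add_of_le' hN
  exact ⟨hsum _, rsIntegral_succ s M⟩
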